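/- There exists a sufficiently small absolute constant c > 0 with the following property. Assume μ ≤ c/(κ‖X‖), ‖L_{X,⊥}ᵀP_{Z_tQ_t}‖ ≤ c/κ, ‖Z_t‖ ≤ 2√‖X‖, ‖Δ_t‖ ≤ (c/κ)·‖sym(X) − Z_tZ_tᵀ + Z̃_tZ̃_tᵀ‖, σ_min(Z_tQ_t) ≥ √(σ_min(X)/8), and ‖Z_tQ_{t,⊥}‖ ≤ c√(σ_min(X)). Then ‖L_Xᵀ(sym(X) − Z_{t+1}Z_{t+1}ᵀ + Z̃_{t+1}Z̃_{t+1}ᵀ)‖ ≤ (1 − (μ/128)σ_min(X)) · ‖L_Xᵀ(sym(X) − Z_tZ_tᵀ + Z̃_tZ̃_tᵀ)‖ + (μ/20)σ_min(X)·‖Z_tQ_{t,⊥}‖². -/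

import Mathlib

open Matrix MeasureTheory ProbabilityTheory

noncomputable section

namespace AsymMatrixSensing

/-- Euclidean norm of a real vector. -/
def euclNorm {ι : Type*} [Fintype ι] (v : ι → ℝ) : ℝ :=
  Real.sqrt (∑ i, v i ^ 2)

/-- Spectral norm of a real matrix. -/
def specNorm {ι₁ ι₂ : Type*} [Fintype ι₁] [Fintype ι₂] (M : Matrix ι₁ ι₂ ℝ) : ℝ :=
  sSup {c : ℝ | ∃ x : ι₂ → ℝ, euclNorm x ≤ 1 ∧ c = euclNorm (M.mulVec x)}

/-- Frobenius norm of a real matrix. -/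
def frobNorm {ι₁ ι₂ : Type*} [Fintype ι₁] [Fintype ι₂] (M : Matrix ι₁ ι₂ ℝ) : ℝ :=
  Real.sqrt (∑ i, ∑ j, M i j ^ 2)

/-- Nuclear norm of a real matrix (characterized by duality with the spectral norm). -/
def nucNorm {ι₁ ι₂ : Type*} [Fintype ι₁] [Fintype ι₂] (M : Matrix ι₁ ι₂ ℝ) : ℝ :=
  sSup {c : ℝ | ∃ B : Matrix ι₁ ι₂ ℝ, specNorm B ≤ 1 ∧ c = ∑ i, ∑ j, M i j * B i j}

/-- Smallest singular value `σ_{min(a,b)}(M)` of a matrix. -/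
def sigmaMin {ι₁ ι₂ : Type*} [Fintype ι₁] [Fintype ι₂] (M : Matrix ι₁ ι₂ ℝ) : ℝ :=
  max (sInf {c : ℝ | ∃ x : ι₂ → ℝ, euclNorm x = 1 ∧ c = euclNorm (M.mulVec x)})
      (sInf {c : ℝ | ∃ y : ι₁ → ℝ, euclNorm y = 1 ∧ c = euclNorm (Mᵀ.mulVec y)})

/-- Smallest nonzero singular value `σ_rank(M)`: the minimum of `‖Mx‖` over unit
vectors `x` orthogonal to the kernel of `M`. -/
def sigmaPos {ι₁ ι₂ : Type*} [Fintype ι₁] [Fintype ι₂] (M : Matrix ι₁ ι₂ ℝ) : ℝ :=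
  sInf {c : ℝ | ∃ x : ι₂ → ℝ, euclNorm x = 1 ∧
    (∀ y : ι₂ → ℝ, M.mulVec y = 0 → x ⬝ᵥ y = 0) ∧ c = euclNorm (M.mulVec x)}

/-- Condition number `κ = ‖M‖ / σ_min(M)`. -/
def condNum {ι₁ ι₂ : Type*} [Fintype ι₁] [Fintype ι₂] (M : Matrix ι₁ ι₂ ℝ) : ℝ :=
  specNorm M / sigmaPos M

/-- Trace inner product `⟨M, N⟩ = trace(Mᵀ N)`. -/
def minner {ι₁ ι₂ : Type*} [Fintype ι₁] [Fintype ι₂] (M N : Matrix ι₁ ι₂ ℝ) : ℝ :=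
  ∑ i, ∑ j, M i j * N i j

/-- `P` is a matrix with orthonormal columns spanning the column space of `M`. -/
def IsOrthCol {ι κ₁ κ₂ : Type*} [Fintype ι] [Fintype κ₁] [Fintype κ₂] [DecidableEq κ₂]
    (P : Matrix ι κ₂ ℝ) (M : Matrix ι κ₁ ℝ) : Prop :=
  Pᵀ * P = 1 ∧ (∃ C : Matrix κ₁ κ₂ ℝ, P = M * C) ∧ P * Pᵀ * M = M

/-- `L` has orthonormal columns spanning the subspace spanned by eigenvectors of the
symmetric matrix `F` corresponding to its `r` largest eigenvalues. -/
def IsTopEigenspace {ι : Type*} [Fintype ι] [DecidableEq ι] {r : ℕ} (F : Matrix ι ι ℝ)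
    (L : Matrix ι (Fin r) ℝ) : Prop :=
  Lᵀ * L = 1 ∧ ∃ d : Fin r → ℝ, F * L = L * Matrix.diagonal d ∧
    ∀ (v : ι → ℝ) (lam : ℝ), v ≠ 0 → F.mulVec v = lam • v →
      Lᵀ.mulVec v = 0 → ∀ i, lam ≤ d i

variable {n₁ n₂ m k r : ℕ}

/-- The measurement operator `𝒜`, given by `[𝒜(Z)]ᵢ = ⟨Aᵢ, Z⟩`. -/
def calA (A : Fin m → Matrix (Fin n₁) (Fin n₂) ℝ) (Z : Matrix (Fin n₁) (Fin n₂) ℝ) :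
    Fin m → ℝ := fun i => minner (A i) Z

/-- The restricted isometry property of order `s` with constant `δ`. -/
def HasRIP (A : Fin m → Matrix (Fin n₁) (Fin n₂) ℝ) (s : ℕ) (δ : ℝ) : Prop :=
  ∀ M : Matrix (Fin n₁) (Fin n₂) ℝ, M.rank ≤ s →
    (1 - δ) * frobNorm M ^ 2 ≤ ∑ i, calA A M i ^ 2 ∧
      ∑ i, calA A M i ^ 2 ≤ (1 + δ) * frobNorm M ^ 2

/-- `𝒜*𝒜`. -/
def AstarA (A : Fin m → Matrix (Fin n₁) (Fin n₂) ℝ) (Z : Matrix (Fin n₁) (Fin n₂) ℝ) :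
    Matrix (Fin n₁) (Fin n₂) ℝ := ∑ i, minner (A i) Z • A i

/-- The symmetrization `sym(X) = [[0, X], [Xᵀ, 0]]`. -/
def symMat (X : Matrix (Fin n₁) (Fin n₂) ℝ) :
    Matrix (Fin n₁ ⊕ Fin n₂) (Fin n₁ ⊕ Fin n₂) ℝ := Matrix.fromBlocks 0 X Xᵀ 0

/-- The symmetrized measurement matrices `Bᵢ = (1/√2)[[0, Aᵢ], [Aᵢᵀ, 0]]`. -/
def Bmat (A : Fin m → Matrix (Fin n₁) (Fin n₂) ℝ) (i : Fin m) :
    Matrix (Fin n₁ ⊕ Fin n₂) (Fin n₁ ⊕ Fin n₂) ℝ :=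
  (Real.sqrt 2)⁻¹ • Matrix.fromBlocks 0 (A i) (A i)ᵀ 0

/-- `ℬ*ℬ`. -/
def BstarB (A : Fin m → Matrix (Fin n₁) (Fin n₂) ℝ)
    (S : Matrix (Fin n₁ ⊕ Fin n₂) (Fin n₁ ⊕ Fin n₂) ℝ) :
    Matrix (Fin n₁ ⊕ Fin n₂) (Fin n₁ ⊕ Fin n₂) ℝ :=
  ∑ i, minner (Bmat A i) S • Bmat A i

/-- The factorized gradient descent iterates `(V_t, W_t)`. -/
def iter (A : Fin m → Matrix (Fin n₁) (Fin n₂) ℝ) (X : Matrix (Fin n₁) (Fin n₂) ℝ)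
    (μ : ℝ) (V₀ : Matrix (Fin n₁) (Fin k) ℝ) (W₀ : Matrix (Fin n₂) (Fin k) ℝ) :
    ℕ → Matrix (Fin n₁) (Fin k) ℝ × Matrix (Fin n₂) (Fin k) ℝ
  | 0 => (V₀, W₀)
  | t + 1 =>
    let p := iter A X μ V₀ W₀ t
    let G := AstarA A (p.1 * p.2ᵀ - X)
    (p.1 - μ • (G * p.2), p.2 - μ • (Gᵀ * p.1))

/-- The vertical stacking `(1/√2)[V; W]`. -/
def Zstack {κ : ℕ} (V : Matrix (Fin n₁) (Fin κ) ℝ) (W : Matrix (Fin n₂) (Fin κ) ℝ) :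
    Matrix (Fin n₁ ⊕ Fin n₂) (Fin κ) ℝ :=
  (Real.sqrt 2)⁻¹ • Matrix.fromRows V W

/-- `Z_t = (1/√2)[V_t; W_t]`. -/
def Zit (A : Fin m → Matrix (Fin n₁) (Fin n₂) ℝ) (X : Matrix (Fin n₁) (Fin n₂) ℝ)
    (μ : ℝ) (V₀ : Matrix (Fin n₁) (Fin k) ℝ) (W₀ : Matrix (Fin n₂) (Fin k) ℝ) (t : ℕ) :
    Matrix (Fin n₁ ⊕ Fin n₂) (Fin k) ℝ :=
  Zstack (iter A X μ V₀ W₀ t).1 (iter A X μ V₀ W₀ t).2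

/-- `Z̃_t = (1/√2)[V_t; −W_t]`. -/
def Ztil (A : Fin m → Matrix (Fin n₁) (Fin n₂) ℝ) (X : Matrix (Fin n₁) (Fin n₂) ℝ)
    (μ : ℝ) (V₀ : Matrix (Fin n₁) (Fin k) ℝ) (W₀ : Matrix (Fin n₂) (Fin k) ℝ) (t : ℕ) :
    Matrix (Fin n₁ ⊕ Fin n₂) (Fin k) ℝ :=
  Zstack (iter A X μ V₀ W₀ t).1 (-(iter A X μ V₀ W₀ t).2)

/-- `Δ_t = (Id − ℬ*ℬ)(Z_tZ_tᵀ − Z̃_tZ̃_tᵀ − sym(X))`. -/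
def Δit (A : Fin m → Matrix (Fin n₁) (Fin n₂) ℝ) (X : Matrix (Fin n₁) (Fin n₂) ℝ)
    (μ : ℝ) (V₀ : Matrix (Fin n₁) (Fin k) ℝ) (W₀ : Matrix (Fin n₂) (Fin k) ℝ) (t : ℕ) :
    Matrix (Fin n₁ ⊕ Fin n₂) (Fin n₁ ⊕ Fin n₂) ℝ :=
  let D := Zit A X μ V₀ W₀ t * (Zit A X μ V₀ W₀ t)ᵀ
    - Ztil A X μ V₀ W₀ t * (Ztil A X μ V₀ W₀ t)ᵀ - symMat X
  D - BstarB A D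

/-- The block diagonal matrix `diag(Id_{n₁}, −Id_{n₂})`. -/
def flipSign (n₁ n₂ : ℕ) : Matrix (Fin n₁ ⊕ Fin n₂) (Fin n₁ ⊕ Fin n₂) ℝ :=
  Matrix.fromBlocks 1 0 0 (-1)

/-- Product Gaussian measure modelling the random initialization pair `(V, W)`
with i.i.d. standard Gaussian entries. -/
def gaussPair (n₁ n₂ k : ℕ) :
    Measure ((Fin n₁ → Fin k → ℝ) × (Fin n₂ → Fin k → ℝ)) :=
  (Measure.pi fun _ : Fin n₁ => Measure.pi fun _ : Fin k => gaussianReal 0 1).prod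
    (Measure.pi fun _ : Fin n₂ => Measure.pi fun _ : Fin k => gaussianReal 0 1)

open scoped Matrix.Norms.L2Operator

section basics
set_option linter.unusedSectionVars false
variable {α β γ δ : Type*} [Fintype α] [Fintype β] [Fintype γ] [Fintype δ]
  [DecidableEq α] [DecidableEq β] [DecidableEq γ] [DecidableEq δ]

theorem euclNorm_eq (v : α → ℝ) : euclNorm v = ‖WithLp.toLp 2 v‖ := by
  rw [EuclideanSpace.norm_eq]; simp [euclNorm]

theorem euclNorm_sq (v : α → ℝ) : euclNorm v ^ 2 = v ⬝ᵥ v := by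
  rw [euclNorm, Real.sq_sqrt (Finset.sum_nonneg fun i _ => sq_nonneg _)]
  simp [dotProduct, sq]

theorem euclNorm_nonneg (v : α → ℝ) : 0 ≤ euclNorm v := Real.sqrt_nonneg _

theorem euclNorm_add (v w : α → ℝ) : euclNorm (v + w) ≤ euclNorm v + euclNorm w := by
  simp only [euclNorm_eq]; exact norm_add_le (WithLp.toLp 2 v) (WithLp.toLp 2 w)

theorem euclNorm_smul (a : ℝ) (v : α → ℝ) : euclNorm (a • v) = |a| * euclNorm v := by
  simp only [euclNorm_eq]; exact norm_smul a (WithLp.toLp 2 v)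

theorem euclNorm_zero_iff (v : α → ℝ) : euclNorm v = 0 ↔ v = 0 := by
  simp only [euclNorm_eq]; simp

theorem dot_le (v w : α → ℝ) : v ⬝ᵥ w ≤ euclNorm v * euclNorm w := by
  simp only [euclNorm_eq]
  have := real_inner_le_norm (WithLp.toLp 2 w) (WithLp.toLp 2 v)
  simpa [EuclideanSpace.inner_toLp_toLp, mul_comm] using this

theorem mulVec_le (M : Matrix α β ℝ) (v : β → ℝ) :
    euclNorm (M *ᵥ v) ≤ ‖M‖ * euclNorm v := by
  simp only [euclNorm_eq]
  exact Matrix.l2_opNorm_mulVec M (WithLp.toLp 2 v)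

theorem norm_le_of (M : Matrix α β ℝ) {C : ℝ} (hC : 0 ≤ C)
    (h : ∀ v, euclNorm (M *ᵥ v) ≤ C * euclNorm v) : ‖M‖ ≤ C := by
  rw [Matrix.l2_opNorm_def]
  refine ContinuousLinearMap.opNorm_le_bound _ hC fun v => ?_
  have := h v.ofLp
  simp only [euclNorm_eq] at this
  exact this

theorem specNorm_eq (M : Matrix α β ℝ) : specNorm M = ‖M‖ := by
  have hne : {c : ℝ | ∃ x : β → ℝ, euclNorm x ≤ 1 ∧ c = euclNorm (M.mulVec x)}.Nonempty :=
    ⟨_, 0, by simp [euclNorm], rfl⟩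
  have hub : ∀ c ∈ {c : ℝ | ∃ x : β → ℝ, euclNorm x ≤ 1 ∧ c = euclNorm (M.mulVec x)}, c ≤ ‖M‖ := by
    rintro c ⟨x, hx, rfl⟩
    exact (mulVec_le M x).trans (mul_le_of_le_one_right (norm_nonneg _) hx)
  apply le_antisymm
  · exact csSup_le hne hub
  · have hnn : 0 ≤ specNorm M := by
      refine le_trans (euclNorm_nonneg (M *ᵥ 0)) (le_csSup ⟨_, hub⟩ ⟨0, by simp [euclNorm], rfl⟩)
    refine norm_le_of _ hnn fun v => ?_
    by_cases hv : euclNorm v = 0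
    · have := (euclNorm_zero_iff v).1 hv
      subst this
      simp [euclNorm]
    have hpos : 0 < euclNorm v := lt_of_le_of_ne (euclNorm_nonneg v) (Ne.symm hv)
    have : euclNorm (M *ᵥ ((euclNorm v)⁻¹ • v)) ≤ specNorm M := by
      refine le_csSup ⟨_, hub⟩ ⟨_, ?_, rfl⟩
      rw [euclNorm_smul, abs_of_pos (inv_pos.2 hpos), inv_mul_cancel₀ hv]
    rw [Matrix.mulVec_smul, euclNorm_smul, abs_of_pos (inv_pos.2 hpos), inv_mul_le_iff₀ hpos] at this
    linarith

theorem norm_tr (M : Matrix α β ℝ) : ‖Mᵀ‖ = ‖M‖ := by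
  rw [← Matrix.conjTranspose_eq_transpose_of_trivial, Matrix.l2_opNorm_conjTranspose]

theorem nm (M : Matrix α β ℝ) (N : Matrix β γ ℝ) : ‖M * N‖ ≤ ‖M‖ * ‖N‖ :=
  Matrix.l2_opNorm_mul M N

theorem nm' (M : Matrix α β ℝ) (N : Matrix β γ ℝ) {a b : ℝ} (ha : ‖M‖ ≤ a) (hb : ‖N‖ ≤ b) :
    ‖M * N‖ ≤ a * b :=
  (nm M N).trans (mul_le_mul ha hb (norm_nonneg _) ((norm_nonneg _).trans ha))

theorem norm_orth (M : Matrix α β ℝ) (h : Mᵀ * M = 1) : ‖M‖ ≤ 1 := by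
  refine norm_le_of _ zero_le_one fun v => ?_
  rw [one_mul]
  refine abs_le_of_sq_le_sq' ?_ (euclNorm_nonneg _) |>.2
  rw [euclNorm_sq, euclNorm_sq, Matrix.dotProduct_mulVec, Matrix.vecMul_mulVec, h]
  simp

/-- Left multiplication by an operator bounded below. -/
theorem norm_lower (B : Matrix α β ℝ) (Y : Matrix β γ ℝ) {s : ℝ} (hs : 0 < s)
    (h : ∀ y, s * euclNorm y ≤ euclNorm (B *ᵥ y)) : s * ‖Y‖ ≤ ‖B * Y‖ := by
  rw [← le_div_iff₀' hs]
  refine norm_le_of _ (by positivity) fun v => ?_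
  have h1 := h (Y *ᵥ v)
  rw [Matrix.mulVec_mulVec] at h1
  have h2 := mulVec_le (B * Y) v
  rw [div_mul_eq_mul_div, le_div_iff₀' hs]
  linarith

theorem lower_transpose (B : Matrix α α ℝ) {s : ℝ} (hs : 0 < s)
    (h : ∀ y, s * euclNorm y ≤ euclNorm (B *ᵥ y)) (x : α → ℝ) :
    s * euclNorm x ≤ euclNorm (Bᵀ *ᵥ x) := by
  have hinj : Function.Injective B.mulVec := by
    intro u v huv
    have := h (u - v)
    rw [Matrix.mulVec_sub, huv, sub_self] at this
    have h0 : euclNorm (0 : α → ℝ) = 0 := by simp [euclNorm]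
    rw [h0] at this
    have h3 : euclNorm (u - v) = 0 :=
      le_antisymm (by by_contra hc; push Not at hc; nlinarith) (euclNorm_nonneg _)
    exact sub_eq_zero.1 ((euclNorm_zero_iff _).1 h3)
  have hsurj : Function.Surjective B.mulVec := by
    rw [Matrix.mulVec_surjective_iff_isUnit]
    exact Matrix.mulVec_injective_iff_isUnit.1 hinj
  obtain ⟨y, rfl⟩ := hsurj x
  by_cases h0 : euclNorm (B *ᵥ y) = 0
  · rw [h0, mul_zero]; exact euclNorm_nonneg _
  have hp : 0 < euclNorm (B *ᵥ y) := lt_of_le_of_ne (euclNorm_nonneg _) (Ne.symm h0)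
  have h1 := euclNorm_sq (B *ᵥ y)
  have h2 : (B *ᵥ y) ⬝ᵥ (B *ᵥ y) = y ⬝ᵥ (Bᵀ *ᵥ (B *ᵥ y)) := by
    rw [Matrix.dotProduct_mulVec, dotProduct_comm, Matrix.mulVec_transpose]
  have h3 := dot_le y (Bᵀ *ᵥ (B *ᵥ y))
  have h4 := h y
  have h5 := euclNorm_nonneg (Bᵀ *ᵥ (B *ᵥ y))
  have h6 : s * euclNorm (B *ᵥ y) ^ 2 ≤ euclNorm (B *ᵥ y) * euclNorm (Bᵀ *ᵥ (B *ᵥ y)) := by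
    rw [h1, h2]
    nlinarith
  nlinarith

/-- Contraction by `1 - μ B Bᵀ`. -/
theorem contr (B : Matrix α β ℝ) {s μ : ℝ} (hs : 0 ≤ s) (hμ : 0 ≤ μ)
    (h : ∀ y, s * euclNorm y ≤ euclNorm (Bᵀ *ᵥ y)) (hB : μ * ‖B‖ ^ 2 ≤ 1)
    (h1 : μ * s ^ 2 ≤ 1) :
    ‖1 - μ • (B * Bᵀ)‖ ≤ 1 - μ * s ^ 2 / 2 := by
  refine norm_le_of _ (by linarith) fun v => ?_
  refine abs_le_of_sq_le_sq' ?_ (mul_nonneg (by linarith) (euclNorm_nonneg _)) |>.2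
  have e1 : (1 - μ • (B * Bᵀ)) *ᵥ v = v - μ • (B *ᵥ (Bᵀ *ᵥ v)) := by
    rw [Matrix.sub_mulVec, Matrix.one_mulVec, Matrix.smul_mulVec, Matrix.mulVec_mulVec]
  set w := Bᵀ *ᵥ v with hw
  have e2 : v ⬝ᵥ (B *ᵥ w) = w ⬝ᵥ w := by
    rw [Matrix.dotProduct_mulVec, hw, Matrix.mulVec_transpose]
  have e3 : (B *ᵥ w) ⬝ᵥ v = w ⬝ᵥ w := by rw [dotProduct_comm, e2]
  have e4 : euclNorm ((1 - μ • (B * Bᵀ)) *ᵥ v) ^ 2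
      = euclNorm v ^ 2 - 2 * μ * euclNorm w ^ 2 + μ ^ 2 * euclNorm (B *ᵥ w) ^ 2 := by
    rw [e1, euclNorm_sq, euclNorm_sq, euclNorm_sq, euclNorm_sq]
    simp only [sub_dotProduct, dotProduct_sub, smul_dotProduct, dotProduct_smul, e2, e3, smul_eq_mul]
    ring
  have b1 : euclNorm (B *ᵥ w) ^ 2 ≤ ‖B‖ ^ 2 * euclNorm w ^ 2 := by
    rw [← mul_pow]
    exact pow_le_pow_left₀ (euclNorm_nonneg _) (mulVec_le B w) 2
  have b2 : s ^ 2 * euclNorm v ^ 2 ≤ euclNorm w ^ 2 := by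
    rw [← mul_pow]
    exact pow_le_pow_left₀ (mul_nonneg hs (euclNorm_nonneg _)) (h v) 2
  have b3 : μ ^ 2 * euclNorm (B *ᵥ w) ^ 2 ≤ μ * euclNorm w ^ 2 := by
    calc μ ^ 2 * euclNorm (B *ᵥ w) ^ 2 ≤ μ ^ 2 * (‖B‖ ^ 2 * euclNorm w ^ 2) := by gcongr
      _ = μ * euclNorm w ^ 2 * (μ * ‖B‖ ^ 2) := by ring
      _ ≤ μ * euclNorm w ^ 2 := mul_le_of_le_one_right (by positivity) hB
  have b4 : μ * (s ^ 2 * euclNorm v ^ 2) ≤ μ * euclNorm w ^ 2 := by gcongr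
  rw [e4, mul_pow]
  nlinarith [sq_nonneg (μ * s ^ 2 * euclNorm v)]

end basics
section core
set_option linter.unusedSectionVars false
variable {ι p κ κ' : Type*} [Fintype ι] [Fintype p] [Fintype κ] [Fintype κ']
  [DecidableEq ι] [DecidableEq p] [DecidableEq κ] [DecidableEq κ']

theorem split_mul {α β : Type*} (Q : Matrix κ p ℝ) (Q' : Matrix κ κ' ℝ)
    (hQ : Q * Qᵀ + Q' * Q'ᵀ = 1) (u : Matrix α κ ℝ) (v : Matrix β κ ℝ) :
    u * vᵀ = (u * Q) * (v * Q)ᵀ + (u * Q') * (v * Q')ᵀ := by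
  have : u * vᵀ = u * (Q * Qᵀ + Q' * Q'ᵀ) * vᵀ := by rw [hQ, Matrix.mul_one]
  rw [this]
  simp only [Matrix.transpose_mul, Matrix.mul_add, Matrix.add_mul, Matrix.mul_assoc]

theorem resid_bound (J : Matrix ι ι ℝ) (L : Matrix ι p ℝ) (Sg : Matrix p p ℝ)
    (Z : Matrix ι κ ℝ) (Q : Matrix κ p ℝ) (Q' : Matrix κ κ' ℝ) (R : Matrix ι ι ℝ)
    (hJt : Jᵀ = J) (hJJ : J * J = 1) (hLL : Lᵀ * L = 1) (hLJL : Lᵀ * (J * L) = 0)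
    (hSt : Sgᵀ = Sg)
    (hR : R = L * Sg * Lᵀ - (J * L) * Sg * (J * L)ᵀ - Z * Zᵀ + (J * Z) * (J * Z)ᵀ)
    (hQ : Lᵀ * Z * Q * Qᵀ = Lᵀ * Z) (hQQ : Q * Qᵀ + Q' * Q'ᵀ = 1)
    (hT : ‖(1 : Matrix ι ι ℝ) - L * Lᵀ‖ ≤ 1) {η s : ℝ}
    (hη : ‖(1 - L * Lᵀ) * (Z * Q)‖ ≤ η) (hs : 0 < s) (hηs : η ≤ s / 100)
    (hlow : ∀ y, s * euclNorm y ≤ euclNorm ((Lᵀ * Z * Q) *ᵥ y)) :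
    ‖R‖ ≤ 5 * ‖Lᵀ * R‖ + 4 * ‖Z * Q'‖ ^ 2 := by
  have hJ1 : ‖J‖ ≤ 1 := norm_orth J (by rw [hJt, hJJ])
  have hL1 : ‖L‖ ≤ 1 := norm_orth L hLL
  have hLt1 : ‖Lᵀ‖ ≤ 1 := by rw [norm_tr]; exact hL1
  have hJLt : (J * L)ᵀ = Lᵀ * J := by rw [Matrix.transpose_mul, hJt]
  have hJZt : (J * Z)ᵀ = Zᵀ * J := by rw [Matrix.transpose_mul, hJt]
  have hJJv : ∀ (v : Matrix ι ι ℝ), J * (J * v) = v := fun v => by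
    rw [← Matrix.mul_assoc, hJJ, Matrix.one_mul]
  have hJJL : J * (J * L) = L := by
    rw [← Matrix.mul_assoc, hJJ, Matrix.one_mul]
  have hLLv : ∀ (v : Matrix p ι ℝ), Lᵀ * (L * v) = v := fun v => by
    rw [← Matrix.mul_assoc, hLL, Matrix.one_mul]
  have hLJLv : ∀ (v : Matrix p ι ℝ), Lᵀ * (J * (L * v)) = 0 := fun v => by
    rw [← Matrix.mul_assoc J, ← Matrix.mul_assoc, hLJL, Matrix.zero_mul]
  set T : Matrix ι ι ℝ := 1 - L * Lᵀ with hTdef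
  set N : Matrix ι ι ℝ := 1 - L * Lᵀ - (J * L) * (J * L)ᵀ with hNdef
  have hNt : Nᵀ = N := by
    simp only [hNdef, Matrix.transpose_sub, Matrix.transpose_mul, Matrix.transpose_transpose,
      Matrix.transpose_one]
  have hRt : Rᵀ = R := by
    rw [hR]
    simp only [Matrix.transpose_sub, Matrix.transpose_add, Matrix.transpose_mul,
      Matrix.transpose_transpose, hSt, hJt, Matrix.mul_assoc]
  have hNL : N * L = 0 := by
    simp only [hNdef, hJLt, Matrix.sub_mul, Matrix.mul_assoc, hLL, hLJL, Matrix.one_mul,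
      Matrix.mul_one, Matrix.mul_zero, sub_self]
  have hNJL : N * (J * L) = 0 := by
    simp only [hNdef, hJLt, Matrix.sub_mul, Matrix.mul_assoc, hLL, hLJL, Matrix.one_mul,
      Matrix.mul_one, Matrix.mul_zero, sub_self, hJJL, sub_zero]
  have hLN : Lᵀ * N = 0 := by
    have := congrArg Matrix.transpose hNL
    rwa [Matrix.transpose_mul, hNt, Matrix.transpose_zero] at this
  have hJLN : (J * L)ᵀ * N = 0 := by
    have := congrArg Matrix.transpose hNJL
    rwa [Matrix.transpose_mul, hNt, Matrix.transpose_zero] at this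
  have hNT : N * T = N := by
    rw [hTdef, Matrix.mul_sub, Matrix.mul_one, ← Matrix.mul_assoc, hNL, Matrix.zero_mul, sub_zero]
  have hNJ : N * J = J * N := by
    simp only [hNdef, hJLt, Matrix.sub_mul, Matrix.mul_sub, Matrix.mul_assoc, hJJ, hJJv,
      Matrix.one_mul, Matrix.mul_one]
    abel
  have hNfac : N = T * (J * (T * J)) := by
    simp only [hNdef, hTdef, hJLt, Matrix.sub_mul, Matrix.mul_sub, Matrix.mul_assoc, hJJ, hJJv,
      Matrix.one_mul, Matrix.mul_one, hLJLv, Matrix.mul_zero, sub_zero]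
  have hN1 : ‖N‖ ≤ 1 := by
    rw [hNfac]
    simpa using nm' _ _ hT (nm' _ _ hJ1 (nm' _ _ hT hJ1))
  set n := N * Z with hn
  set a := Lᵀ * Z with ha
  set b := Lᵀ * (J * Z) with hb
  set q := ‖Z * Q'‖ with hq
  set ρ := ‖Lᵀ * R‖ with hρ
  have hq0 : 0 ≤ q := norm_nonneg _
  have hρ0 : 0 ≤ ρ := norm_nonneg _
  have hη0 : 0 ≤ η := (norm_nonneg _).trans hη
  have hnt : nᵀ = Zᵀ * N := by rw [hn, Matrix.transpose_mul, hNt]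
  have hJZN : (J * Z)ᵀ * N = nᵀ * J := by
    rw [hJZt, hnt, Matrix.mul_assoc, Matrix.mul_assoc, hNJ]
  have hRN : R * N = -(Z * nᵀ) + (J * Z) * (nᵀ * J) := by
    rw [hR, hnt]
    simp only [Matrix.sub_mul, Matrix.add_mul]
    rw [Matrix.mul_assoc (L * Sg), hLN, Matrix.mul_assoc (J * L * Sg), hJLN,
      Matrix.mul_assoc (J * Z), hJZN, hnt, Matrix.mul_assoc Z]
    simp
  have hLRN : Lᵀ * R * N = -(a * nᵀ) + b * nᵀ * J := by
    rw [Matrix.mul_assoc, hRN, Matrix.mul_add, Matrix.mul_neg, ha, hb]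
    simp only [Matrix.mul_assoc]
  have hNRN : N * R * N = -(n * nᵀ) + J * (n * nᵀ) * J := by
    rw [Matrix.mul_assoc, hRN, Matrix.mul_add, Matrix.mul_neg]
    have : N * (J * Z * (nᵀ * J)) = J * (n * nᵀ) * J := by
      rw [← Matrix.mul_assoc, ← Matrix.mul_assoc N J Z, hNJ, Matrix.mul_assoc J N Z, ← hn]
      simp only [Matrix.mul_assoc]
    rw [this, ← Matrix.mul_assoc]
  have hJTJ : Lᵀ * J * T = Lᵀ * J := by
    rw [hTdef, Matrix.mul_sub, Matrix.mul_one, ← Matrix.mul_assoc, Matrix.mul_assoc _ J L, hLJL,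
      Matrix.zero_mul, sub_zero]
  have hbQ : ‖b * Q‖ ≤ η := by
    have : b * Q = Lᵀ * (J * (T * (Z * Q))) := by
      rw [← Matrix.mul_assoc, ← Matrix.mul_assoc, hJTJ, hb]
      simp only [Matrix.mul_assoc]
    rw [this]
    simpa using nm' _ _ hLt1 (nm' _ _ hJ1 hη)
  have hbQ' : ‖b * Q'‖ ≤ q := by
    have : b * Q' = Lᵀ * (J * (Z * Q')) := by
      rw [hb]; simp only [Matrix.mul_assoc]
    rw [this]
    simpa using nm' _ _ hLt1 (nm' _ _ hJ1 hq.ge)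
  have hnQ : ‖n * Q‖ ≤ η := by
    have : n * Q = N * (T * (Z * Q)) := by
      rw [← Matrix.mul_assoc, hNT, hn, Matrix.mul_assoc]
    rw [this]
    simpa using nm' _ _ hN1 hη
  have hnQ' : ‖n * Q'‖ ≤ q := by
    rw [hn, Matrix.mul_assoc]
    simpa using nm' _ _ hN1 hq.ge
  set ν := ‖n * Q‖ with hν
  have hν0 : 0 ≤ ν := norm_nonneg _
  have han : a * nᵀ = (a * Q) * (n * Q)ᵀ := by
    rw [Matrix.transpose_mul n Q, ← Matrix.mul_assoc, hQ]
  have h1 : s * ν ≤ ‖a * nᵀ‖ := by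
    rw [han, hν, ← norm_tr (n * Q)]
    exact norm_lower _ _ hs hlow
  have h2 : ‖a * nᵀ‖ ≤ ρ + (η * ν + q * q) := by
    have e : a * nᵀ = -(Lᵀ * R * N) + b * nᵀ * J := by rw [hLRN]; abel
    rw [e]
    refine (norm_add_le _ _).trans (add_le_add ?_ ?_)
    · rw [norm_neg]; simpa using nm' _ _ hρ.ge hN1
    · rw [split_mul Q Q' hQQ b n]
      have k1 : ‖(b * Q) * (n * Q)ᵀ‖ ≤ η * ν := nm' _ _ hbQ (norm_tr _).le
      have k2 : ‖(b * Q') * (n * Q')ᵀ‖ ≤ q * q := nm' _ _ hbQ' ((norm_tr _).le.trans hnQ')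
      have k3 := (norm_add_le ((b * Q) * (n * Q)ᵀ) ((b * Q') * (n * Q')ᵀ)).trans (add_le_add k1 k2)
      simpa using nm' _ _ k3 hJ1
  have h3 : ‖n * nᵀ‖ ≤ ν * ν + q * q := by
    rw [split_mul Q Q' hQQ n n]
    refine (norm_add_le _ _).trans (add_le_add ?_ ?_)
    · exact nm' _ _ le_rfl (norm_tr _).le
    · exact nm' _ _ hnQ' ((norm_tr _).le.trans hnQ')
  have h4 : ‖N * R * N‖ ≤ 2 * (ν * ν + q * q) := by
    rw [hNRN, two_mul]
    refine (norm_add_le _ _).trans (add_le_add ?_ ?_)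
    · rwa [norm_neg]
    · simpa using nm' _ _ (nm' _ _ hJ1 h3) hJ1
  have h5 : 2 * (ν * ν + q * q) ≤ ρ + 4 * q ^ 2 := by
    have w1 : s * ν ≤ ρ + η * ν + q * q := by linarith
    have w2 : η * ν ≤ s / 100 * ν := by gcongr
    have w3 : ν * ν ≤ s / 100 * ν := by
      have : ν * ν ≤ η * ν := by gcongr
      linarith
    nlinarith
  have hRJ : R * J = -(J * R) := by
    rw [hR]
    simp only [hJLt, hJZt, Matrix.sub_mul, Matrix.add_mul, Matrix.mul_sub, Matrix.mul_add,
      Matrix.mul_assoc, hJJ, hJJv, Matrix.mul_one]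
    abel
  have hJLR : ‖(J * L)ᵀ * R‖ ≤ ρ := by
    have : (J * L)ᵀ * R = -(Lᵀ * R * J) := by
      rw [hJLt, Matrix.mul_assoc, Matrix.mul_assoc, hRJ, Matrix.mul_neg, neg_neg]
    rw [this, norm_neg]
    simpa using nm' _ _ hρ.ge hJ1
  have hJL1 : ‖J * L‖ ≤ 1 := by simpa using nm' _ _ hJ1 hL1
  have e0 : (1 : Matrix ι ι ℝ) = L * Lᵀ + (J * L) * (J * L)ᵀ + N := by rw [hNdef]; abel
  have e1 : R = L * (Lᵀ * R) + (J * L) * ((J * L)ᵀ * R) + N * R := by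
    conv_lhs => rw [← Matrix.one_mul R, e0]
    simp only [Matrix.add_mul, Matrix.mul_assoc]
  have e2 : N * R = N * (Lᵀ * R)ᵀ * Lᵀ + N * ((J * L)ᵀ * R)ᵀ * (J * L)ᵀ + N * R * N := by
    conv_lhs => rw [← Matrix.mul_one (N * R), e0]
    simp only [Matrix.mul_add, Matrix.mul_assoc, Matrix.transpose_mul, Matrix.transpose_transpose,
      hRt]
  have f1 : ‖L * (Lᵀ * R)‖ ≤ 1 * ρ := nm' _ _ hL1 hρ.ge
  have f2 : ‖(J * L) * ((J * L)ᵀ * R)‖ ≤ 1 * ρ := nm' _ _ hJL1 hJLR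
  have f3 : ‖N * (Lᵀ * R)ᵀ * Lᵀ‖ ≤ 1 * ρ * 1 := nm' _ _ (nm' _ _ hN1 (norm_tr _).le) hLt1
  have f4 : ‖N * ((J * L)ᵀ * R)ᵀ * (J * L)ᵀ‖ ≤ 1 * ρ * 1 :=
    nm' _ _ (nm' _ _ hN1 ((norm_tr _).le.trans hJLR)) ((norm_tr _).le.trans hJL1)
  have g2 : ‖N * R‖ ≤ ρ + ρ + (ρ + 4 * q ^ 2) := by
    rw [e2]
    refine (norm_add_le _ _).trans (add_le_add ((norm_add_le _ _).trans (add_le_add ?_ ?_)) ?_) <;>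
      linarith
  have g1 : ‖R‖ ≤ ρ + ρ + ‖N * R‖ := by
    conv_lhs => rw [e1]
    refine (norm_add_le _ _).trans (add_le_add ((norm_add_le _ _).trans (add_le_add ?_ ?_)) ?_) <;>
      linarith
  linarith

end core
section core2
set_option linter.unusedSectionVars false
variable {ι p κ κ' : Type*} [Fintype ι] [Fintype p] [Fintype κ] [Fintype κ']
  [DecidableEq ι] [DecidableEq p] [DecidableEq κ] [DecidableEq κ']

theorem expand_step (X0 R Rp M : Matrix ι ι ℝ) (Z W : Matrix ι κ ℝ) (μ : ℝ) (hM : Mᵀ = M)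
    (hR : R = X0 - Z * Zᵀ + W * Wᵀ)
    (hRp : Rp = X0 - (Z + μ • (M * Z)) * (Z + μ • (M * Z))ᵀ
      + (W - μ • (M * W)) * (W - μ • (M * W))ᵀ) :
    Rp = R - μ • (M * (Z * Zᵀ + W * Wᵀ)) - μ • ((Z * Zᵀ + W * Wᵀ) * M)
      - (μ * μ) • (M * (Z * Zᵀ - W * Wᵀ) * M) := by
  rw [hRp, hR]
  simp only [Matrix.transpose_add, Matrix.transpose_sub, Matrix.transpose_smul,
    Matrix.transpose_mul, hM, Matrix.add_mul, Matrix.mul_add, Matrix.sub_mul, Matrix.mul_sub,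
    Matrix.smul_mul, Matrix.mul_smul, Matrix.mul_assoc]
  module

theorem expand_L (R Rp M Δ S D : Matrix ι ι ℝ) (L : Matrix ι p ℝ) (K : Matrix p p ℝ) (μ : ℝ)
    (hM : M = R + Δ)
    (hRp : Rp = R - μ • (M * S) - μ • (S * M) - (μ * μ) • (M * D * M)) :
    Lᵀ * Rp = (1 - μ • K) * (Lᵀ * R) * (1 - μ • S) - μ • ((Lᵀ * S - K * Lᵀ) * R)
      - (μ * μ) • (K * (Lᵀ * R) * S) - μ • (Lᵀ * Δ * S) - μ • (Lᵀ * S * Δ)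
      - (μ * μ) • (Lᵀ * M * D * M) := by
  have h1 : M * S = R * S + Δ * S := by rw [hM, Matrix.add_mul]
  have h2 : S * M = S * R + S * Δ := by rw [hM, Matrix.mul_add]
  rw [hRp, h1, h2]
  simp only [Matrix.add_mul, Matrix.mul_add, Matrix.sub_mul, Matrix.mul_sub,
    Matrix.smul_mul, Matrix.mul_smul, Matrix.mul_assoc, Matrix.one_mul, Matrix.mul_one]
  module

theorem norm_S (Z W : Matrix ι κ ℝ) {z μ : ℝ} (hμ : 0 ≤ μ) (hZ : ‖Z‖ ≤ z) (hW : ‖W‖ ≤ z)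
    (h : μ * (2 * z ^ 2) ≤ 1) : ‖1 - μ • (Z * Zᵀ + W * Wᵀ)‖ ≤ 1 := by
  have e : Z * Zᵀ + W * Wᵀ = Matrix.fromCols Z W * (Matrix.fromCols Z W)ᵀ := by
    rw [Matrix.transpose_fromCols, Matrix.fromCols_mul_fromRows]
  have hn : ‖Z * Zᵀ + W * Wᵀ‖ ≤ 2 * z ^ 2 := by
    refine (norm_add_le _ _).trans ?_
    have := nm' _ _ hZ ((norm_tr Z).le.trans hZ)
    have := nm' _ _ hW ((norm_tr W).le.trans hW)
    linarith
  have hC : ‖Matrix.fromCols Z W‖ ^ 2 = ‖Z * Zᵀ + W * Wᵀ‖ := by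
    rw [e]
    have := Matrix.l2_opNorm_conjTranspose_mul_self (Matrix.fromCols Z W)ᵀ
    rw [Matrix.conjTranspose_eq_transpose_of_trivial, Matrix.transpose_transpose, norm_tr] at this
    rw [this, sq]
  rw [e]
  have := contr (Matrix.fromCols Z W) (s := 0) (μ := μ) le_rfl hμ
    (fun y => by rw [zero_mul]; exact euclNorm_nonneg _)
    (by rw [hC]; exact (mul_le_mul_of_nonneg_left hn hμ).trans h) (by simp)
  simpa using this

set_option maxHeartbeats 1000000 in
theorem contraction (J : Matrix ι ι ℝ) (L : Matrix ι p ℝ) (Sg : Matrix p p ℝ)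
    (Z : Matrix ι κ ℝ) (Q : Matrix κ p ℝ) (Q' : Matrix κ κ' ℝ) (R Rp M Δ : Matrix ι ι ℝ)
    (hJt : Jᵀ = J) (hJJ : J * J = 1) (hLL : Lᵀ * L = 1) (hLJL : Lᵀ * (J * L) = 0)
    (hSt : Sgᵀ = Sg)
    (hR : R = L * Sg * Lᵀ - (J * L) * Sg * (J * L)ᵀ - Z * Zᵀ + (J * Z) * (J * Z)ᵀ)
    (hQQ1 : Qᵀ * Q = 1)
    (hQ : Lᵀ * Z * Q * Qᵀ = Lᵀ * Z) (hQQ : Q * Qᵀ + Q' * Q'ᵀ = 1)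
    (hT : ‖(1 : Matrix ι ι ℝ) - L * Lᵀ‖ ≤ 1) {η s μ x z d : ℝ}
    (hη : ‖(1 - L * Lᵀ) * (Z * Q)‖ ≤ η) (hs : 0 < s) (hηs : η ≤ s / 100)
    (hlow : ∀ y, s * euclNorm y ≤ euclNorm ((Lᵀ * Z * Q) *ᵥ y))
    (hμ : 0 < μ) (hM : M = R + Δ) (hMt : Mᵀ = M)
    (hRp : Rp = L * Sg * Lᵀ - (J * L) * Sg * (J * L)ᵀ
      - (Z + μ • (M * Z)) * (Z + μ • (M * Z))ᵀ
      + (J * Z - μ • (M * (J * Z))) * (J * Z - μ • (M * (J * Z)))ᵀ)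
    (hSg : ‖Sg‖ ≤ x) (hz : ‖Z‖ ≤ z) (hzx : z ^ 2 = 4 * x) (hΔ : ‖Δ‖ ≤ d * ‖R‖) (hd0 : 0 ≤ d)
    (hd : d ≤ 1) (hμz : μ * (2 * z ^ 2) ≤ 1) (hμs : μ * s ^ 2 ≤ 1) :
    ‖Lᵀ * Rp‖ ≤ (1 - μ * s ^ 2 / 2) * ‖Lᵀ * R‖ + μ * μ * (32 * x ^ 2) * ‖Lᵀ * R‖
      + (μ * (2 * z * η + ‖Z * Q'‖ ^ 2) + 16 * μ * d * x + μ * μ * (320 * x ^ 2)) *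
        (5 * ‖Lᵀ * R‖ + 4 * ‖Z * Q'‖ ^ 2) := by
  have hres := resid_bound J L Sg Z Q Q' R hJt hJJ hLL hLJL hSt hR hQ hQQ hT hη hs hηs hlow
  have hx0 : 0 ≤ x := (norm_nonneg _).trans hSg
  have hz0 : 0 ≤ z := (norm_nonneg _).trans hz
  have hη0 : 0 ≤ η := (norm_nonneg _).trans hη
  have hJ1 : ‖J‖ ≤ 1 := norm_orth J (by rw [hJt, hJJ])
  have hL1 : ‖L‖ ≤ 1 := norm_orth L hLL
  have hQ1 : ‖Q‖ ≤ 1 := norm_orth Q hQQ1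
  have hLt1 : ‖Lᵀ‖ ≤ 1 := by rw [norm_tr]; exact hL1
  have hJL1 : ‖J * L‖ ≤ 1 := by simpa using nm' _ _ hJ1 hL1
  have hJZ : ‖J * Z‖ ≤ z := by simpa using nm' _ _ hJ1 hz
  set ρ := ‖Lᵀ * R‖ with hρ
  set q := ‖Z * Q'‖ with hq
  have hρ0 : 0 ≤ ρ := norm_nonneg _
  have hq0 : 0 ≤ q := norm_nonneg _
  set W := J * Z with hW
  set S := Z * Zᵀ + W * Wᵀ with hS
  set D := Z * Zᵀ - W * Wᵀ with hD
  set T : Matrix ι ι ℝ := 1 - L * Lᵀ with hTdef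
  set B := Lᵀ * Z * Q with hB
  have hZZ : ‖Z * Zᵀ‖ ≤ z * z := nm' _ _ hz ((norm_tr _).le.trans hz)
  have hWW : ‖W * Wᵀ‖ ≤ z * z := nm' _ _ hJZ ((norm_tr _).le.trans hJZ)
  have hzz : z * z = 4 * x := by rw [← hzx]; ring
  have hSn : ‖S‖ ≤ 8 * x := (norm_add_le _ _).trans (by linarith)
  have hDn : ‖D‖ ≤ 8 * x := (norm_sub_le _ _).trans (by linarith)
  have hBn : ‖B‖ ≤ z := by simpa using nm' _ _ (nm' _ _ hLt1 hz) hQ1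
  have hZQ : ‖Z * Q‖ ≤ z := by simpa using nm' _ _ hz hQ1
  have hBB : ‖B * Bᵀ‖ ≤ z * z := nm' _ _ hBn ((norm_tr _).le.trans hBn)
  have hRx : ‖R‖ ≤ 10 * x := by
    rw [hR]
    have k1 : ‖L * Sg * Lᵀ‖ ≤ 1 * x * 1 := nm' _ _ (nm' _ _ hL1 hSg) hLt1
    have k2 : ‖(J * L) * Sg * (J * L)ᵀ‖ ≤ 1 * x * 1 :=
      nm' _ _ (nm' _ _ hJL1 hSg) ((norm_tr _).le.trans hJL1)
    refine (norm_add_le _ _).trans ?_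
    have k3 := norm_sub_le (L * Sg * Lᵀ - (J * L) * Sg * (J * L)ᵀ) (Z * Zᵀ)
    have k4 := norm_sub_le (L * Sg * Lᵀ) ((J * L) * Sg * (J * L)ᵀ)
    linarith
  have hMn : ‖M‖ ≤ 2 * ‖R‖ := by
    rw [hM]
    have := mul_le_mul_of_nonneg_right hd (norm_nonneg R)
    exact (norm_add_le _ _).trans (by linarith)
  set e := 5 * ρ + 4 * q ^ 2 with he
  have he0 : 0 ≤ e := by positivity
  -- the left contraction
  have hlowt := lower_transpose B hs hlow
  have c1 : ‖1 - μ • (B * Bᵀ)‖ ≤ 1 - μ * s ^ 2 / 2 := by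
    refine contr B hs.le hμ.le hlowt ?_ hμs
    have h1 : ‖B‖ ^ 2 ≤ z ^ 2 := pow_le_pow_left₀ (norm_nonneg _) hBn 2
    have h2 := mul_le_mul_of_nonneg_left h1 hμ.le
    have h3 : 0 ≤ μ * z ^ 2 := by positivity
    linarith
  have c2 : ‖1 - μ • S‖ ≤ 1 := norm_S Z W hμ.le hz hJZ hμz
  -- the cross term
  have hbQ : ‖Lᵀ * W * Q‖ ≤ η := by
    have hJTJ : Lᵀ * J * T = Lᵀ * J := by
      rw [hTdef, Matrix.mul_sub, Matrix.mul_one, ← Matrix.mul_assoc, Matrix.mul_assoc _ J L, hLJL,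
        Matrix.zero_mul, sub_zero]
    have : Lᵀ * W * Q = Lᵀ * (J * (T * (Z * Q))) := by
      calc Lᵀ * W * Q = Lᵀ * J * (Z * Q) := by rw [hW]; simp only [Matrix.mul_assoc]
        _ = Lᵀ * J * T * (Z * Q) := by rw [hJTJ]
        _ = Lᵀ * (J * (T * (Z * Q))) := by simp only [Matrix.mul_assoc]
    rw [this]
    simpa using nm' _ _ hLt1 (nm' _ _ hJ1 hη)
  have hWQ : ‖W * Q‖ ≤ z := by simpa using nm' _ _ hJZ hQ1
  have hWQ' : ‖W * Q'‖ ≤ q := by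
    rw [hW, Matrix.mul_assoc]; simpa using nm' _ _ hJ1 hq.ge
  have hLWQ' : ‖Lᵀ * W * Q'‖ ≤ q := by
    rw [Matrix.mul_assoc]; simpa using nm' _ _ hLt1 hWQ'
  have hY : Lᵀ * S - B * Bᵀ * Lᵀ = B * (T * (Z * Q))ᵀ
      + ((Lᵀ * W * Q) * (W * Q)ᵀ + (Lᵀ * W * Q') * (W * Q')ᵀ) := by
    rw [← split_mul Q Q' hQQ]
    have h1 : Lᵀ * Z * Zᵀ = B * (Z * Q)ᵀ := by
      rw [Matrix.transpose_mul, ← Matrix.mul_assoc, hB, hQ]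
    have h2 : T * (Z * Q) = Z * Q - L * B := by
      rw [hTdef, Matrix.sub_mul, Matrix.one_mul, hB]; simp only [Matrix.mul_assoc]
    rw [h2, hS, Matrix.mul_add, ← Matrix.mul_assoc, h1, ← Matrix.mul_assoc, Matrix.transpose_sub,
      Matrix.mul_sub, Matrix.transpose_mul L B, Matrix.mul_assoc B]
    abel
  have hYn : ‖Lᵀ * S - B * Bᵀ * Lᵀ‖ ≤ 2 * z * η + q ^ 2 := by
    rw [hY]
    have k1 : ‖B * (T * (Z * Q))ᵀ‖ ≤ z * η := nm' _ _ hBn ((norm_tr _).le.trans hη)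
    have k2 : ‖(Lᵀ * W * Q) * (W * Q)ᵀ‖ ≤ η * z := nm' _ _ hbQ ((norm_tr _).le.trans hWQ)
    have k3 : ‖(Lᵀ * W * Q') * (W * Q')ᵀ‖ ≤ q * q := nm' _ _ hLWQ' ((norm_tr _).le.trans hWQ')
    refine (norm_add_le _ _).trans ?_
    have k4 := norm_add_le ((Lᵀ * W * Q) * (W * Q)ᵀ) ((Lᵀ * W * Q') * (W * Q')ᵀ)
    have k5 : 2 * z * η + q ^ 2 = z * η + (η * z + q * q) := by ring
    linarith
  have hexp := expand_L R Rp M Δ S D L (B * Bᵀ) μ hM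
    (expand_step _ R Rp M Z W μ hMt hR hRp)
  have t1 : ‖(1 - μ • (B * Bᵀ)) * (Lᵀ * R) * (1 - μ • S)‖ ≤ (1 - μ * s ^ 2 / 2) * ρ * 1 :=
    nm' _ _ (nm' _ _ c1 hρ.ge) c2
  have t2 : ‖(Lᵀ * S - B * Bᵀ * Lᵀ) * R‖ ≤ (2 * z * η + q ^ 2) * e := nm' _ _ hYn hres
  have t3 : ‖(B * Bᵀ) * (Lᵀ * R) * S‖ ≤ (z * z) * ρ * (8 * x) := nm' _ _ (nm' _ _ hBB hρ.ge) hSn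
  have hΔe : ‖Δ‖ ≤ d * e := hΔ.trans (by gcongr)
  have t4 : ‖Lᵀ * Δ * S‖ ≤ 1 * (d * e) * (8 * x) := nm' _ _ (nm' _ _ hLt1 hΔe) hSn
  have t5 : ‖Lᵀ * S * Δ‖ ≤ 1 * (8 * x) * (d * e) := nm' _ _ (nm' _ _ hLt1 hSn) hΔe
  have t6 : ‖Lᵀ * M * D * M‖ ≤ 1 * (2 * e) * (8 * x) * (2 * (10 * x)) :=
    nm' _ _ (nm' _ _ (nm' _ _ hLt1 (hMn.trans (by gcongr))) hDn) (hMn.trans (by gcongr))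
  have ns : ∀ (a : ℝ) (A : Matrix p ι ℝ) (b : ℝ), 0 ≤ a → ‖A‖ ≤ b → ‖a • A‖ ≤ a * b := by
    intro a A b ha hb
    rw [norm_smul, Real.norm_of_nonneg ha]
    exact mul_le_mul_of_nonneg_left hb ha
  rw [hexp]
  have hμ2 : 0 ≤ μ * μ := by positivity
  refine (norm_sub_le_of_le (norm_sub_le_of_le (norm_sub_le_of_le (norm_sub_le_of_le
    (norm_sub_le_of_le t1 (ns _ _ _ hμ.le t2)) (ns _ _ _ hμ2 t3)) (ns _ _ _ hμ.le t4))
    (ns _ _ _ hμ.le t5)) (ns _ _ _ hμ2 t6)).trans ?_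
  rw [hzz]
  apply le_of_eq
  ring

end core2
section glue

theorem sqrt2_inv : (Real.sqrt 2)⁻¹ * (Real.sqrt 2)⁻¹ = 1 / 2 := by
  rw [← mul_inv, Real.mul_self_sqrt (by norm_num)]; norm_num

theorem Zstack_mul_tr {n₁ n₂ a : ℕ} (V V' : Matrix (Fin n₁) (Fin a) ℝ)
    (W W' : Matrix (Fin n₂) (Fin a) ℝ) :
    Zstack V W * (Zstack V' W')ᵀ
      = (1 / 2 : ℝ) • Matrix.fromBlocks (V * V'ᵀ) (V * W'ᵀ) (W * V'ᵀ) (W * W'ᵀ) := by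
  rw [Zstack, Zstack, Matrix.transpose_smul, Matrix.smul_mul, Matrix.mul_smul, smul_smul,
    sqrt2_inv, Matrix.transpose_fromRows, Matrix.fromRows_mul_fromCols]

theorem Zstack_tr_mul {n₁ n₂ a b : ℕ} (V : Matrix (Fin n₁) (Fin a) ℝ)
    (W : Matrix (Fin n₂) (Fin a) ℝ) (V' : Matrix (Fin n₁) (Fin b) ℝ)
    (W' : Matrix (Fin n₂) (Fin b) ℝ) :
    (Zstack V W)ᵀ * (Zstack V' W') = (1 / 2 : ℝ) • (Vᵀ * V' + Wᵀ * W') := by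
  rw [Zstack, Zstack, Matrix.transpose_smul, Matrix.smul_mul, Matrix.mul_smul, smul_smul,
    sqrt2_inv, Matrix.transpose_fromRows, Matrix.fromCols_mul_fromRows]

theorem flip_Zstack {n₁ n₂ a : ℕ} (V : Matrix (Fin n₁) (Fin a) ℝ)
    (W : Matrix (Fin n₂) (Fin a) ℝ) : flipSign n₁ n₂ * Zstack V W = Zstack V (-W) := by
  rw [flipSign, Zstack, Zstack, Matrix.mul_smul, Matrix.fromBlocks_mul_fromRows]
  simp

theorem flip_tr {n₁ n₂ : ℕ} : (flipSign n₁ n₂)ᵀ = flipSign n₁ n₂ := by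
  simp [flipSign, Matrix.fromBlocks_transpose]

theorem flip_sq {n₁ n₂ : ℕ} : flipSign n₁ n₂ * flipSign n₁ n₂ = 1 := by
  simp [flipSign, Matrix.fromBlocks_multiply]

theorem symMat_mul_Zstack {n₁ n₂ a : ℕ} (Y : Matrix (Fin n₁) (Fin n₂) ℝ)
    (V : Matrix (Fin n₁) (Fin a) ℝ) (W : Matrix (Fin n₂) (Fin a) ℝ) :
    symMat Y * Zstack V W = Zstack (Y * W) (Yᵀ * V) := by
  rw [symMat, Zstack, Zstack, Matrix.mul_smul, Matrix.fromBlocks_mul_fromRows]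
  simp

theorem diff_eq {n₁ n₂ a : ℕ} (V : Matrix (Fin n₁) (Fin a) ℝ) (W : Matrix (Fin n₂) (Fin a) ℝ) :
    Zstack V W * (Zstack V W)ᵀ - Zstack V (-W) * (Zstack V (-W))ᵀ = symMat (V * Wᵀ) := by
  rw [Zstack_mul_tr, Zstack_mul_tr, symMat, ← smul_sub]
  ext i j
  rcases i with i | i <;> rcases j with j | j <;>
    simp [Matrix.transpose_mul] <;> ring

theorem BstarB_sym {n₁ n₂ m : ℕ} (A : Fin m → Matrix (Fin n₁) (Fin n₂) ℝ)
    (Y : Matrix (Fin n₁) (Fin n₂) ℝ) : BstarB A (symMat Y) = symMat (AstarA A Y) := by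
  have hm : ∀ i, minner (Bmat A i) (symMat Y) = (Real.sqrt 2)⁻¹ * 2 * minner (A i) Y := by
    intro i
    simp only [minner, Bmat, symMat, Fintype.sum_sum_type, Matrix.smul_apply,
      Matrix.fromBlocks_apply₁₁, Matrix.fromBlocks_apply₁₂, Matrix.fromBlocks_apply₂₁,
      Matrix.fromBlocks_apply₂₂, Matrix.zero_apply, Matrix.transpose_apply, smul_eq_mul]
    have : ∑ x : Fin n₂, ∑ y : Fin n₁, (Real.sqrt 2)⁻¹ * A i y x * Y y x
        = ∑ y : Fin n₁, ∑ x : Fin n₂, (Real.sqrt 2)⁻¹ * A i y x * Y y x := Finset.sum_comm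
    simp only [mul_zero, Finset.sum_const_zero, add_zero, zero_add]
    rw [this, mul_right_comm, ← two_mul, mul_comm 2, Finset.mul_sum]
    congr 1
    refine Finset.sum_congr rfl fun y _ => ?_
    rw [Finset.mul_sum]
    exact Finset.sum_congr rfl fun x _ => by ring
  have h2 : ∀ i, minner (Bmat A i) (symMat Y) • Bmat A i = symMat (minner (A i) Y • A i) := by
    intro i
    rw [hm, Bmat, smul_smul]
    have : (Real.sqrt 2)⁻¹ * 2 * minner (A i) Y * (Real.sqrt 2)⁻¹ = minner (A i) Y := by
      linear_combination 2 * minner (A i) Y * sqrt2_inv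
    rw [this, symMat, Matrix.fromBlocks_smul]
    simp [Matrix.transpose_smul]
  rw [BstarB, AstarA]
  simp only [h2]
  ext i j
  rcases i with i | i <;> rcases j with j | j <;> simp [symMat, Matrix.sum_apply]

theorem symMat_neg {n₁ n₂ : ℕ} (Y : Matrix (Fin n₁) (Fin n₂) ℝ) : symMat (-Y) = -symMat Y := by
  simp [symMat, Matrix.fromBlocks_neg]

theorem symMat_sub {n₁ n₂ : ℕ} (Y Y' : Matrix (Fin n₁) (Fin n₂) ℝ) :
    symMat (Y - Y') = symMat Y - symMat Y' := by
  rw [sub_eq_add_neg, sub_eq_add_neg, ← symMat_neg]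
  simp [symMat, Matrix.fromBlocks_add]

theorem symMat_tr {n₁ n₂ : ℕ} (Y : Matrix (Fin n₁) (Fin n₂) ℝ) : (symMat Y)ᵀ = symMat Y := by
  simp [symMat, Matrix.fromBlocks_transpose]

theorem AstarA_neg {n₁ n₂ m : ℕ} (A : Fin m → Matrix (Fin n₁) (Fin n₂) ℝ)
    (Y : Matrix (Fin n₁) (Fin n₂) ℝ) : AstarA A (-Y) = -AstarA A Y := by
  simp [AstarA, minner]

theorem Zstack_add_smul {n₁ n₂ a : ℕ} (V V' : Matrix (Fin n₁) (Fin a) ℝ)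
    (W W' : Matrix (Fin n₂) (Fin a) ℝ) (c : ℝ) :
    Zstack V W + c • Zstack V' W' = Zstack (V + c • V') (W + c • W') := by
  ext i j
  rcases i with i | i <;> simp [Zstack] <;> ring

theorem symMat_svd {n₁ n₂ r : ℕ} (P : Matrix (Fin n₁) (Fin r) ℝ) (Q : Matrix (Fin n₂) (Fin r) ℝ)
    (d : Fin r → ℝ) :
    symMat (P * Matrix.diagonal d * Qᵀ) = Zstack P Q * Matrix.diagonal d * (Zstack P Q)ᵀ
      - Zstack P (-Q) * Matrix.diagonal d * (Zstack P (-Q))ᵀ := by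
  have h : ∀ (Q' : Matrix (Fin n₂) (Fin r) ℝ), Zstack P Q' * Matrix.diagonal d
      = Zstack (P * Matrix.diagonal d) (Q' * Matrix.diagonal d) := by
    intro Q'
    rw [Zstack, Zstack, Matrix.smul_mul, Matrix.fromRows_mul]
  rw [h, h, Zstack_mul_tr, Zstack_mul_tr, symMat, ← smul_sub]
  ext i j
  rcases i with i | i <;> rcases j with j | j <;>
    simp [Matrix.transpose_mul, Matrix.mul_assoc] <;> ring

/-- Completing an orthonormal family. -/
theorem complete_proj {ι a b : Type*} [Fintype ι] [Fintype a] [Fintype b] [DecidableEq ι]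
    [DecidableEq a] [DecidableEq b] (L : Matrix ι a ℝ) (Lp : Matrix ι b ℝ)
    (h1 : Lᵀ * L = 1) (h2 : Lpᵀ * Lp = 1) (h3 : Lᵀ * Lp = 0)
    (hc : Fintype.card ι = Fintype.card a + Fintype.card b) :
    L * Lᵀ + Lp * Lpᵀ = 1 := by
  have h4 : Lpᵀ * L = 0 := by
    have := congrArg Matrix.transpose h3
    simpa [Matrix.transpose_mul] using this
  have e : (Matrix.fromCols L Lp)ᵀ * Matrix.fromCols L Lp = 1 := by
    rw [Matrix.transpose_fromCols, Matrix.fromRows_mul_fromCols, h1, h2, h3, h4,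
      Matrix.fromBlocks_one]
  replace e := (Matrix.mul_eq_one_comm_of_card_eq _ _ _ (by simp [hc])).1 e
  rwa [Matrix.transpose_fromCols, Matrix.fromCols_mul_fromRows] at e

theorem card_le_of_orth {a b : ℕ} (P : Matrix (Fin a) (Fin b) ℝ) (h : Pᵀ * P = 1) : b ≤ a := by
  have h1 : (Pᵀ * P).rank = b := by rw [h, Matrix.rank_one]; simp
  have h2 := Matrix.rank_mul_le_right Pᵀ P
  have h3 := Matrix.rank_le_card_height P
  simp only [Fintype.card_fin] at h3
  omega

theorem sigmaPos_facts {n₁ n₂ r : ℕ} (P : Matrix (Fin n₁) (Fin r) ℝ)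
    (Q : Matrix (Fin n₂) (Fin r) ℝ) (d : Fin r → ℝ) (hP : Pᵀ * P = 1) (hQ : Qᵀ * Q = 1)
    (hd : ∀ i, 0 < d i) (hr : 0 < r) :
    0 < sigmaPos (P * Matrix.diagonal d * Qᵀ) ∧
      sigmaPos (P * Matrix.diagonal d * Qᵀ) ≤ ‖P * Matrix.diagonal d * Qᵀ‖ := by
  set X := P * Matrix.diagonal d * Qᵀ with hX
  have iso : ∀ {a : ℕ} (U : Matrix (Fin a) (Fin r) ℝ), Uᵀ * U = 1 → ∀ v,
      euclNorm (U *ᵥ v) = euclNorm v := by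
    intro a U hU v
    have : euclNorm (U *ᵥ v) ^ 2 = euclNorm v ^ 2 := by
      rw [euclNorm_sq, euclNorm_sq, Matrix.dotProduct_mulVec, Matrix.vecMul_mulVec, hU]
      simp
    exact (pow_left_inj₀ (euclNorm_nonneg _) (euclNorm_nonneg _) two_ne_zero).1 this
  have hne : (Finset.univ : Finset (Fin r)).Nonempty := ⟨⟨0, hr⟩, Finset.mem_univ _⟩
  obtain ⟨i0, -, hi0⟩ := Finset.exists_min_image Finset.univ d hne
  have hex : ∃ x : Fin n₂ → ℝ, euclNorm x = 1 ∧
      (∀ y : Fin n₂ → ℝ, X.mulVec y = 0 → x ⬝ᵥ y = 0) := by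
    refine ⟨Q *ᵥ Pi.single i0 1, ?_, ?_⟩
    · rw [iso Q hQ]; simp [euclNorm, Pi.single_apply]
    · intro y hy
      have h1 : Pᵀ *ᵥ (X *ᵥ y) = Matrix.diagonal d *ᵥ (Qᵀ *ᵥ y) := by
        rw [Matrix.mulVec_mulVec, hX, Matrix.mulVec_mulVec, ← Matrix.mul_assoc, ← Matrix.mul_assoc,
          hP, Matrix.one_mul]
      rw [hy, Matrix.mulVec_zero] at h1
      have h2 := congrFun h1 i0
      rw [Matrix.mulVec_diagonal] at h2
      have h3 : (Qᵀ *ᵥ y) i0 = 0 := by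
        rcases mul_eq_zero.1 h2.symm with h | h
        · exact absurd h (hd i0).ne'
        · exact h
      rw [dotProduct_comm, Matrix.dotProduct_mulVec, ← Matrix.mulVec_transpose]
      simpa using h3
  have hlow : ∀ x : Fin n₂ → ℝ, euclNorm x = 1 →
      (∀ y : Fin n₂ → ℝ, X.mulVec y = 0 → x ⬝ᵥ y = 0) → d i0 ≤ euclNorm (X *ᵥ x) := by
    intro x hx hk
    set u := Qᵀ *ᵥ x with hu
    have hxe : x = Q *ᵥ u := by
      have hX0 : X *ᵥ (x - Q *ᵥ u) = 0 := by
        have : Qᵀ *ᵥ (x - Q *ᵥ u) = 0 := by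
          rw [Matrix.mulVec_sub, Matrix.mulVec_mulVec, hQ, Matrix.one_mulVec, hu, sub_self]
        rw [hX, ← Matrix.mulVec_mulVec, this, Matrix.mulVec_zero]
      have h1 := hk _ hX0
      have h2 : (Q *ᵥ u) ⬝ᵥ (x - Q *ᵥ u) = 0 := by
        rw [dotProduct_comm, Matrix.dotProduct_mulVec, ← Matrix.mulVec_transpose,
          Matrix.mulVec_sub, Matrix.mulVec_mulVec, hQ, Matrix.one_mulVec, hu, sub_self,
          zero_dotProduct]
      have h3 : euclNorm (x - Q *ᵥ u) ^ 2 = 0 := by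
        rw [euclNorm_sq, sub_dotProduct, h1, h2, sub_zero]
      exact sub_eq_zero.1 ((euclNorm_zero_iff _).1 (pow_eq_zero_iff two_ne_zero |>.1 h3))
    have hun : euclNorm u = 1 := by rw [← hx, hxe, iso Q hQ]
    have hXx : X *ᵥ x = P *ᵥ (Matrix.diagonal d *ᵥ u) := by
      rw [hX, hu, Matrix.mulVec_mulVec, Matrix.mulVec_mulVec]
    rw [hXx, iso P hP]
    have h5 : (d i0 * euclNorm u) ^ 2 ≤ euclNorm (Matrix.diagonal d *ᵥ u) ^ 2 := by
      rw [mul_pow, euclNorm_sq, euclNorm_sq]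
      simp only [dotProduct, Matrix.mulVec_diagonal, Finset.mul_sum]
      refine Finset.sum_le_sum fun i _ => ?_
      have := hi0 i (Finset.mem_univ _)
      have h6 : d i0 ^ 2 ≤ d i ^ 2 := pow_le_pow_left₀ (hd i0).le this 2
      nlinarith [mul_self_nonneg (u i)]
    have h7 := (abs_le_of_sq_le_sq' h5 (euclNorm_nonneg _)).2
    rwa [hun, mul_one] at h7
  obtain ⟨x0, hx0, hk0⟩ := hex
  constructor
  · refine (hd i0).trans_le (le_csInf ⟨_, x0, hx0, hk0, rfl⟩ ?_)
    rintro c ⟨x, hx, hk, rfl⟩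
    exact hlow x hx hk
  · have h9 : sigmaPos X ≤ euclNorm (X *ᵥ x0) := by
      refine csInf_le ⟨0, ?_⟩ ⟨x0, hx0, hk0, rfl⟩
      rintro c ⟨x, _, _, rfl⟩; exact euclNorm_nonneg _
    refine h9.trans ?_
    simpa [hx0] using mulVec_le X x0

theorem sigmaMin_lower {α β : Type*} [Fintype α] [Fintype β] [DecidableEq α] [DecidableEq β]
    (M : Matrix α β ℝ) (hc : Fintype.card β < Fintype.card α)
    {s : ℝ} (hs : 0 < s) (h : s ≤ sigmaMin M) (y : β → ℝ) :
    s * euclNorm y ≤ euclNorm (M *ᵥ y) := by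
  have norml : ∀ {γ : Type _} [Fintype γ] [DecidableEq γ] (v : γ → ℝ), euclNorm v ≠ 0 →
      euclNorm ((euclNorm v)⁻¹ • v) = 1 := by
    intro γ _ _ v hv
    rw [euclNorm_smul, abs_of_nonneg (inv_nonneg.2 (euclNorm_nonneg _)), inv_mul_cancel₀ hv]
  have hB : sInf {c : ℝ | ∃ y : α → ℝ, euclNorm y = 1 ∧ c = euclNorm (Mᵀ.mulVec y)} ≤ 0 := by
    have hk : LinearMap.ker (Matrix.mulVecLin Mᵀ) ≠ ⊥ := by
      apply LinearMap.ker_ne_bot_of_finrank_lt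
      simpa using hc
    obtain ⟨v, hv, hv0⟩ := (Submodule.ne_bot_iff _).1 hk
    have hvn : euclNorm v ≠ 0 := fun h0 => hv0 ((euclNorm_zero_iff v).1 h0)
    have hMv : Mᵀ *ᵥ v = 0 := hv
    refine csInf_le ⟨0, ?_⟩ ⟨(euclNorm v)⁻¹ • v, ?_, ?_⟩
    · rintro c ⟨x, _, rfl⟩; exact euclNorm_nonneg _
    · rw [euclNorm_smul, abs_of_nonneg (inv_nonneg.2 (euclNorm_nonneg _)), inv_mul_cancel₀ hvn]
    · rw [Matrix.mulVec_smul, hMv, smul_zero]; simp [euclNorm]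
  have hA : s ≤ sInf {c : ℝ | ∃ x : β → ℝ, euclNorm x = 1 ∧ c = euclNorm (M.mulVec x)} := by
    rcases le_max_iff.1 h with h | h
    · exact h
    · linarith
  by_cases hy : euclNorm y = 0
  · rw [hy, mul_zero]; exact euclNorm_nonneg _
  have hp : 0 < euclNorm y := lt_of_le_of_ne (euclNorm_nonneg _) (Ne.symm hy)
  have h1 : s ≤ euclNorm (M *ᵥ ((euclNorm y)⁻¹ • y)) := by
    refine hA.trans (csInf_le ⟨0, ?_⟩ ⟨_, norml y hy, rfl⟩)
    rintro c ⟨x, _, rfl⟩; exact euclNorm_nonneg _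
  rw [Matrix.mulVec_smul, euclNorm_smul, abs_of_pos (inv_pos.2 hp)] at h1
  rw [inv_mul_eq_div, le_div_iff₀ hp] at h1
  exact h1

end glue
set_option maxHeartbeats 1000000 in
/-- local linear convergence of the projected residual. -/
theorem statement17_local_convergence :
    ∃ c : ℝ, 0 < c ∧
    ∀
    (n₁ n₂ m k r : ℕ)
    (A : Fin m → Matrix (Fin n₁) (Fin n₂) ℝ) (X : Matrix (Fin n₁) (Fin n₂) ℝ)
    (PX : Matrix (Fin n₁) (Fin r) ℝ) (QX : Matrix (Fin n₂) (Fin r) ℝ) (σX : Fin r → ℝ)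
    (hPX : PXᵀ * PX = 1) (hQX : QXᵀ * QX = 1)
    (hσpos : ∀ i, 0 < σX i) (hσanti : Antitone σX)
    (hXsvd : X = PX * Matrix.diagonal σX * QXᵀ)
    (μ : ℝ) (hμ : 0 < μ)
    (V₀ : Matrix (Fin n₁) (Fin k) ℝ) (W₀ : Matrix (Fin n₂) (Fin k) ℝ)
    (Z Z' : ℕ → Matrix (Fin n₁ ⊕ Fin n₂) (Fin k) ℝ)
    (hZ : Z = Zit A X μ V₀ W₀) (hZ' : Z' = Ztil A X μ V₀ W₀)
    (LX : Matrix (Fin n₁ ⊕ Fin n₂) (Fin r) ℝ) (hLX : LX = Zstack PX QX)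
    (κ σm : ℝ) (hκ : κ = condNum X) (hσm : σm = sigmaPos X)
    (Δ : ℕ → Matrix (Fin n₁ ⊕ Fin n₂) (Fin n₁ ⊕ Fin n₂) ℝ) (hΔ : Δ = Δit A X μ V₀ W₀)
    (LXp : Matrix (Fin n₁ ⊕ Fin n₂) (Fin (n₁ + n₂ - r)) ℝ)
    (hLXp1 : LXpᵀ * LXp = 1) (hLXp2 : LXᵀ * LXp = 0)
    (t : ℕ)
    (Qt : Matrix (Fin k) (Fin r) ℝ) (hQt1 : Qtᵀ * Qt = 1)
    (hQt2 : LXᵀ * Z t * Qt * Qtᵀ = LXᵀ * Z t)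
    (Qtp : Matrix (Fin k) (Fin (k - r)) ℝ) (hQtp1 : Qtpᵀ * Qtp = 1) (hQtp2 : Qtᵀ * Qtp = 0)
    (PZ : Matrix (Fin n₁ ⊕ Fin n₂) (Fin r) ℝ) (hPZ : IsOrthCol PZ (Z t * Qt))
    (h1 : μ ≤ c / (κ * specNorm X))
    (h2 : specNorm (LXpᵀ * PZ) ≤ c / κ)
    (h3 : specNorm (Z t) ≤ 2 * Real.sqrt (specNorm X))
    (h4 : specNorm (Δ t) ≤ c / κ * specNorm (symMat X - Z t * (Z t)ᵀ + Z' t * (Z' t)ᵀ))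
    (h5 : Real.sqrt (σm / 8) ≤ sigmaMin (Z t * Qt))
    (h6 : specNorm (Z t * Qtp) ≤ c * Real.sqrt σm),
    specNorm (LXᵀ * (symMat X - Z (t + 1) * (Z (t + 1))ᵀ + Z' (t + 1) * (Z' (t + 1))ᵀ))
      ≤ (1 - μ / 128 * σm) * specNorm (LXᵀ * (symMat X - Z t * (Z t)ᵀ + Z' t * (Z' t)ᵀ))
        + μ / 20 * σm * specNorm (Z t * Qtp) ^ 2 := by
  refine ⟨1 / 100000, by norm_num, ?_⟩
  intro n₁ n₂ m k r A X PX QX σX hPX hQX hσpos hσanti hXsvd μ hμ V₀ W₀ Z Z' hZ hZ' LX hLX κ σm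
    hκ hσm Δ hΔ LXp hLXp1 hLXp2 t Qt hQt1 hQt2 Qtp hQtp1 hQtp2 PZ hPZ h1 h2 h3 h4 h5 h6
  simp only [specNorm_eq] at h1 h2 h3 h4 h6 ⊢
  rcases Nat.eq_zero_or_pos r with hr | hr
  · subst hr
    have hz : ∀ M : Matrix (Fin n₁ ⊕ Fin n₂) (Fin n₁ ⊕ Fin n₂) ℝ, LXᵀ * M = 0 := by
      intro M; ext i; exact i.elim0
    have hσ0 : σm = 0 := by
      have hX0 : X = 0 := by
        rw [hXsvd]; ext i j; simp [Matrix.mul_apply]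
      have : {c : ℝ | ∃ x : Fin n₂ → ℝ, euclNorm x = 1 ∧
          (∀ y : Fin n₂ → ℝ, X.mulVec y = 0 → x ⬝ᵥ y = 0) ∧ c = euclNorm (X.mulVec x)} = ∅ := by
        rw [Set.eq_empty_iff_forall_notMem]
        rintro c ⟨x, hx, hk, -⟩
        have h0 := hk x (by rw [hX0, Matrix.zero_mulVec])
        rw [← euclNorm_sq, hx] at h0
        norm_num at h0
      rw [hσm, sigmaPos, this, Real.sInf_empty]
    rw [hz, hz, hσ0]
    simp
  obtain ⟨hσ, hσx⟩ := sigmaPos_facts PX QX σX hPX hQX hσpos hr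
  rw [← hXsvd, ← hσm] at hσ hσx
  set x := ‖X‖ with hx
  have hx0 : 0 < x := hσ.trans_le hσx
  have hκ' : κ = x / σm := by rw [hκ, condNum, specNorm_eq, ← hσm]
  have hck : (1 / 100000 : ℝ) / κ = σm / x / 100000 := by rw [hκ']; field_simp
  have hckx : (1 / 100000 : ℝ) / (κ * x) = σm / x ^ 2 / 100000 := by rw [hκ']; field_simp
  rw [hck] at h2 h4
  rw [hckx] at h1
  set d := σm / x / 100000 with hd
  have hd0 : 0 ≤ d := by positivity
  have hdx : d * x = σm / 100000 := by rw [hd]; field_simp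
  have hrn1 := card_le_of_orth PX hPX
  have hrn2 := card_le_of_orth QX hQX
  have hrk := card_le_of_orth Qt hQt1
  have hcard : Fintype.card (Fin n₁ ⊕ Fin n₂) = n₁ + n₂ := by simp
  set J := flipSign n₁ n₂ with hJ
  have hJL : J * LX = Zstack PX (-QX) := by rw [hLX, hJ, flip_Zstack]
  have hLL : LXᵀ * LX = 1 := by
    rw [hLX, Zstack_tr_mul, hPX, hQX]; module
  have hLJL : LXᵀ * (J * LX) = 0 := by
    rw [hJL, hLX, Zstack_tr_mul, Matrix.mul_neg, hPX, hQX]; simp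
  have hproj := complete_proj LX LXp hLL hLXp1 hLXp2 (by simp; omega)
  have hQQ := complete_proj Qt Qtp hQt1 hQtp1 hQtp2 (by simp; omega)
  have hTe : 1 - LX * LXᵀ = LXp * LXpᵀ := by rw [← hproj]; abel
  have hLp1 := norm_orth LXp hLXp1
  have hLpt1 : ‖LXpᵀ‖ ≤ 1 := (norm_tr _).le.trans hLp1
  have hT : ‖(1 : Matrix (Fin n₁ ⊕ Fin n₂) (Fin n₁ ⊕ Fin n₂) ℝ) - LX * LXᵀ‖ ≤ 1 := by
    rw [hTe]; simpa using nm' _ _ hLp1 hLpt1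
  set z := 2 * Real.sqrt x with hz
  have hzx : z ^ 2 = 4 * x := by rw [hz, mul_pow, Real.sq_sqrt hx0.le]; norm_num
  have hz0 : 0 ≤ z := by positivity
  have hZQ : ‖Z t * Qt‖ ≤ z := by simpa using nm' _ _ h3 (norm_orth Qt hQt1)
  have hη : ‖(1 - LX * LXᵀ) * (Z t * Qt)‖ ≤ d * z := by
    obtain ⟨hP1, -, hP3⟩ := hPZ
    have e : (1 - LX * LXᵀ) * (Z t * Qt) = LXp * (LXpᵀ * PZ * (PZᵀ * (Z t * Qt))) := by
      conv_lhs => rw [hTe, ← hP3]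
      simp only [Matrix.mul_assoc]
    rw [e]
    have k1 : ‖PZᵀ‖ ≤ 1 := (norm_tr _).le.trans (norm_orth PZ hP1)
    simpa using nm' _ _ hLp1 (nm' _ _ h2 (nm' _ _ k1 hZQ))
  set w := Real.sqrt σm with hw
  have hw0 : 0 < w := Real.sqrt_pos.2 hσ
  have hw2 : w ^ 2 = σm := Real.sq_sqrt hσ.le
  have hηw : d * z ≤ w / 50000 := by
    have k1 : w ≤ Real.sqrt x := Real.sqrt_le_sqrt hσx
    have k2 : d * Real.sqrt x * Real.sqrt x = w * w / 100000 := by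
      rw [mul_assoc, Real.mul_self_sqrt hx0.le, hdx, ← hw2]; ring
    have k3 : w * w / 100000 ≤ w / 100000 * Real.sqrt x := by nlinarith
    have k4 : 0 < Real.sqrt x := Real.sqrt_pos.2 hx0
    have k5 : d * Real.sqrt x ≤ w / 100000 := by
      by_contra hc
      push Not at hc
      nlinarith
    rw [hz]; linarith
  have hs8 : 0.353 * w ≤ Real.sqrt (σm / 8) := by
    apply Real.le_sqrt_of_sq_le
    rw [mul_pow, hw2]
    linarith
  have hlow : ∀ y, w / 3 * euclNorm y ≤ euclNorm ((LXᵀ * Z t * Qt) *ᵥ y) := by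
    intro y
    have a1 := sigmaMin_lower (Z t * Qt) (by simp; omega) (by positivity) (hs8.trans h5) y
    have e : (Z t * Qt) *ᵥ y = LX *ᵥ ((LXᵀ * Z t * Qt) *ᵥ y)
        + ((1 - LX * LXᵀ) * (Z t * Qt)) *ᵥ y := by
      rw [Matrix.mulVec_mulVec, ← Matrix.add_mulVec]
      congr 1
      rw [Matrix.sub_mul, Matrix.one_mul]
      simp only [Matrix.mul_assoc]
      abel
    have a2 := euclNorm_add (LX *ᵥ ((LXᵀ * Z t * Qt) *ᵥ y)) (((1 - LX * LXᵀ) * (Z t * Qt)) *ᵥ y)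
    rw [← e] at a2
    have a3 := mulVec_le LX ((LXᵀ * Z t * Qt) *ᵥ y)
    have a4 := mulVec_le ((1 - LX * LXᵀ) * (Z t * Qt)) y
    have a5 := mul_le_mul_of_nonneg_right (norm_orth LX hLL)
      (euclNorm_nonneg ((LXᵀ * Z t * Qt) *ᵥ y))
    have a6 := mul_le_mul_of_nonneg_right (hη.trans hηw) (euclNorm_nonneg y)
    have a7 := mul_nonneg hw0.le (euclNorm_nonneg y)
    linarith
  -- structure of the iterates
  have hZ't : ∀ j, Z' j = J * Z j := by
    intro j; rw [hZ, hZ', Zit, Ztil, hJ, flip_Zstack]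
  set V := (iter A X μ V₀ W₀ t).1 with hV
  set W := (iter A X μ V₀ W₀ t).2 with hW
  have hZt : Z t = Zstack V W := by rw [hZ, Zit]
  set R := symMat X - Z t * (Z t)ᵀ + Z' t * (Z' t)ᵀ with hR
  have hRsym : R = symMat (X - V * Wᵀ) := by
    have := diff_eq V W
    rw [hR, hZ't, hZt, hJ, flip_Zstack, symMat_sub, ← this]; abel
  set M := symMat (AstarA A (X - V * Wᵀ)) with hM
  have hMR : M = R + Δ t := by
    have e1 : Zit A X μ V₀ W₀ t * (Zit A X μ V₀ W₀ t)ᵀ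
        - Ztil A X μ V₀ W₀ t * (Ztil A X μ V₀ W₀ t)ᵀ - symMat X = symMat (-(X - V * Wᵀ)) := by
      rw [symMat_neg, ← hRsym, hR, hZ, hZ']; abel
    rw [hΔ, Δit]
    simp only [e1]
    rw [BstarB_sym, AstarA_neg, symMat_neg, symMat_neg, ← hM, ← hRsym]
    abel
  have hG : AstarA A (V * Wᵀ - X) = -AstarA A (X - V * Wᵀ) := by rw [← AstarA_neg, neg_sub]
  have hZ1 : Z (t + 1) = Z t + μ • (M * Z t) := by
    rw [hZt, hM, symMat_mul_Zstack, Zstack_add_smul, hZ, Zit, iter]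
    simp only [← hV, ← hW, hG, Matrix.transpose_neg, Matrix.neg_mul, smul_neg, sub_neg_eq_add]
  have hZ1' : Z' (t + 1) = J * Z t - μ • (M * (J * Z t)) := by
    rw [hZ't, hZ1, Matrix.mul_add, Matrix.mul_smul]
    have : J * (M * Z t) = -(M * (J * Z t)) := by
      rw [hZt, hM, hJ, symMat_mul_Zstack, flip_Zstack, flip_Zstack, symMat_mul_Zstack]
      ext i j
      rcases i with i | i <;> simp [Zstack]
    rw [this, smul_neg, ← sub_eq_add_neg]
  have hsv : symMat X = LX * Matrix.diagonal σX * LXᵀ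
      - (J * LX) * Matrix.diagonal σX * (J * LX)ᵀ := by
    rw [hJL, hLX, hXsvd, symMat_svd]
  have hSg : ‖Matrix.diagonal σX‖ ≤ x := by
    have e : Matrix.diagonal σX = PXᵀ * X * QX := by
      rw [hXsvd]
      simp only [Matrix.mul_assoc]
      rw [hQX, Matrix.mul_one, ← Matrix.mul_assoc, hPX, Matrix.one_mul]
    rw [e]
    simpa using nm' _ _ (nm' _ _ ((norm_tr _).le.trans (norm_orth PX hPX)) hx.ge)
      (norm_orth QX hQX)
  have hμx : μ * x ^ 2 ≤ σm / 100000 := by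
    have := mul_le_mul_of_nonneg_right h1 (sq_nonneg x)
    refine this.trans (le_of_eq ?_)
    field_simp
  have hμx1 : μ * x ≤ 1 / 100000 := by
    have : μ * x * x ≤ 1 / 100000 * x := by nlinarith
    exact le_of_mul_le_mul_right this hx0
  have hμσ : μ * σm ≤ 1 / 100000 := (mul_le_mul_of_nonneg_left hσx hμ.le).trans hμx1
  have key := contraction J LX (Matrix.diagonal σX) (Z t) Qt Qtp R
    (symMat X - Z (t + 1) * (Z (t + 1))ᵀ + Z' (t + 1) * (Z' (t + 1))ᵀ) M (Δ t)
    flip_tr flip_sq hLL hLJL (Matrix.diagonal_transpose _)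
    (by rw [hR, hZ't, hsv]) hQt1 hQt2 hQQ hT (η := d * z) (s := w / 3) (μ := μ) (x := x) (z := z)
    (d := d) hη (by positivity) (by linarith) hlow hμ hMR (symMat_tr _)
    (by rw [hZ1, hZ1', hsv]) hSg h3 hzx h4 hd0
    (by
      have : d * x ≤ 1 * x := by rw [hdx]; linarith
      exact le_of_mul_le_mul_right this hx0)
    (by rw [hzx]; linarith) (by rw [div_pow, hw2]; linarith)
  refine key.trans ?_
  set ρ := ‖LXᵀ * R‖ with hρ
  set q := ‖Z t * Qtp‖ with hq
  have hρ0 : 0 ≤ ρ := norm_nonneg _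
  have hq0 : 0 ≤ q := norm_nonneg _
  have hq2 : q ^ 2 ≤ σm / 100000 := by
    have := pow_le_pow_left₀ hq0 h6 2
    rw [mul_pow, hw2] at this
    linarith
  have hco : μ * (2 * z * (d * z) + q ^ 2) + 16 * μ * d * x + μ * μ * (320 * x ^ 2)
      ≤ 345 * (μ * σm) / 100000 := by
    have k1 : 2 * z * (d * z) = 8 * (d * x) := by
      have : 2 * z * (d * z) = 2 * d * z ^ 2 := by ring
      rw [this, hzx]; ring
    have k2 : 16 * μ * d * x = 16 * μ * (d * x) := by ring
    have k3 : μ * μ * (320 * x ^ 2) = 320 * μ * (μ * x ^ 2) := by ring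
    rw [k1, k2, k3, hdx]
    have k4 := mul_le_mul_of_nonneg_left hq2 hμ.le
    have k5 := mul_le_mul_of_nonneg_left hμx hμ.le
    linarith
  have hco2 : μ * μ * (32 * x ^ 2) ≤ 32 * (μ * σm) / 100000 := by
    have k5 := mul_le_mul_of_nonneg_left hμx hμ.le
    linarith
  have m1 := mul_le_mul_of_nonneg_right hco (show 0 ≤ 5 * ρ + 4 * q ^ 2 by positivity)
  have m2 := mul_le_mul_of_nonneg_right hco2 hρ0
  have m3 : 0 ≤ μ * σm * ρ := by positivity
  have m4 : 0 ≤ μ * σm * q ^ 2 := by positivity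
  have m5 : (w / 3) ^ 2 = σm / 9 := by rw [div_pow, hw2]; norm_num
  rw [m5]
  linarith

end AsymMatrixSensing
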